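/- Fractional product estimate for powers: let d ≥ 1, γ ∈ [2,∞), s ∈ (0,1), and α ∈ ((γ−4)/(γ−2), 2) (for γ = 2 this means α ∈ (−∞,2)). Then there exists a constant C > 0 (depending only on d, γ, s, α) such that for every real-valued Schwartz function f on ℝ^d, ‖|f|^{γ−2} f‖_{Ḣ^s} ≤ C ‖f‖_{L^{2γ/(2−α)}}^{γ−2} ‖f‖_{Ḣ^{s + (d/2 − d/γ)(2−α)}}. -/

import Mathlib

open MeasureTheory
open scoped ENNReal FourierTransform

/-- `x ↦ |x|^β x` is locally Lipschitz, with constant growing like `|x|^β`. -/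
theorem abs_rpow_mul_sub_le {β : ℝ} (hβ : 0 ≤ β) (a b : ℝ) :
    |(|a| ^ β * a - |b| ^ β * b)| ≤ (β + 2) * ((|a| ^ β + |b| ^ β) * |a - b|) := by
  wlog h : |b| ≤ |a| generalizing a b
  · have := this b a (le_of_not_ge h)
    rwa [abs_sub_comm, add_comm (|b| ^ β), abs_sub_comm b a] at this
  have hb0 := Real.rpow_nonneg (abs_nonneg b) β
  have ha0 := Real.rpow_nonneg (abs_nonneg a) β
  have key : (|a| ^ β - |b| ^ β) * |b| ≤ (β + 1) * (|a| ^ β * (|a| - |b|)) := by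
    rcases (abs_nonneg a).eq_or_lt with h0 | hpos
    · have hb : |b| = 0 := le_antisymm (h.trans h0.symm.le) (abs_nonneg b)
      simp [hb, ← h0]
    · have h1 := one_add_mul_self_le_rpow_one_add (s := |b| / |a| - 1)
        (by linarith [div_nonneg (abs_nonneg b) (abs_nonneg a)]) (p := β + 1) (by linarith)
      rw [add_sub_cancel, Real.div_rpow (abs_nonneg b) (abs_nonneg a),
        Real.rpow_add_one' (abs_nonneg b) (by linarith),
        Real.rpow_add_one hpos.ne', le_div_iff₀ (by positivity)] at h1
      have h2 : |b| / |a| * |a| = |b| := div_mul_cancel₀ _ hpos.ne'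
      have h3 : (1 + (β + 1) * (|b| / |a| - 1)) * (|a| ^ β * |a|) =
          |a| ^ β * |a| + (β + 1) * (|a| ^ β * (|b| - |a|)) := by
        calc _ = |a| ^ β * |a| + (β + 1) * (|a| ^ β * (|b| / |a| * |a| - |a|)) := by ring
          _ = _ := by rw [h2]
      rw [h3] at h1
      nlinarith [mul_le_mul_of_nonneg_left h ha0]
  have hmono : |b| ^ β ≤ |a| ^ β := Real.rpow_le_rpow (abs_nonneg b) h hβ
  have htri : |a| - |b| ≤ |a - b| := abs_sub_abs_le_abs_sub a b
  calc |(|a| ^ β * a - |b| ^ β * b)| = |(|a| ^ β * (a - b) + (|a| ^ β - |b| ^ β) * b)| := by ring_nf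
    _ ≤ |a| ^ β * |a - b| + (|a| ^ β - |b| ^ β) * |b| := by
        refine (abs_add_le _ _).trans_eq ?_
        rw [abs_mul, abs_mul, abs_of_nonneg ha0, abs_of_nonneg (sub_nonneg.2 hmono)]
    _ ≤ |a| ^ β * |a - b| + (β + 1) * (|a| ^ β * |a - b|) := by
        have h4 := mul_le_mul_of_nonneg_left htri ha0
        have h5 := mul_le_mul_of_nonneg_left h4 (by linarith : 0 ≤ β + 1)
        linarith
    _ ≤ (β + 2) * ((|a| ^ β + |b| ^ β) * |a - b|) := by
        have := mul_nonneg hb0 (abs_nonneg (a - b))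
        nlinarith

section Euclidean

variable {E : Type*} [NormedAddCommGroup E] [InnerProductSpace ℝ E] [FiniteDimensional ℝ E]
  [MeasurableSpace E] [BorelSpace E]

theorem lintegral_comp_smul_of_pos (f : E → ℝ≥0∞) {R : ℝ} (hR : 0 < R) :
    ∫⁻ x, f (R • x) = ENNReal.ofReal (R ^ (-(Module.finrank ℝ E : ℝ))) * ∫⁻ x, f x := by
  have h := Measure.map_addHaar_smul (volume : Measure E) hR.ne'
  have h2 := lintegral_map_equiv (μ := (volume : Measure E)) f
    (Homeomorph.smulOfNeZero R hR.ne').toMeasurableEquiv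
  have h3 : Measure.map (Homeomorph.smulOfNeZero R hR.ne').toMeasurableEquiv
    (volume : Measure E) = Measure.map (R • ·) volume := rfl
  rw [h3, h, lintegral_smul_measure] at h2
  rw [Real.rpow_neg hR.le, Real.rpow_natCast, ← abs_of_pos (inv_pos.2 (pow_pos hR _))]
  exact h2.symm

theorem fourier_toLp_ae_eq {u : E → ℂ} (hu : Integrable u) (hu2 : MemLp u 2) :
    (𝓕 (hu2.toLp u) : Lp ℂ 2 (volume : Measure E)) =ᵐ[volume] 𝓕 u := by
  have hcont : Continuous (𝓕 u) := VectorFourier.fourierIntegral_continuous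
    Real.continuous_fourierChar (by exact continuous_inner) hu
  refine ae_eq_of_integral_contDiff_smul_eq
    ((Lp.memLp _).locallyIntegrable (by norm_num)) hcont.locallyIntegrable ?_
  intro g hg hgc
  have hg₁ : HasCompactSupport (Complex.ofRealCLM ∘ g) := hgc.comp_left rfl
  have hg₂ : ContDiff ℝ (⊤ : ℕ∞) (Complex.ofRealCLM ∘ g) := by fun_prop
  let φ : SchwartzMap E ℂ := hg₁.toSchwartzMap hg₂
  have h := congrArg (fun T => T φ) (Lp.fourier_toTemperedDistribution_eq (hu2.toLp u))
  simp only [TemperedDistribution.fourier_apply, Lp.toTemperedDistribution_apply] at h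
  have h1 : ∫ x, g x • ((𝓕 (hu2.toLp u) : Lp ℂ 2 (volume : Measure E)) x) =
      ∫ x, φ x • ((𝓕 (hu2.toLp u) : Lp ℂ 2 (volume : Measure E)) x) := rfl
  have h2 : ∫ x, g x • 𝓕 u x = ∫ x, φ x • 𝓕 u x := rfl
  rw [h1, h2, ← h]
  have h3 : ∫ x, 𝓕 φ x • (hu2.toLp u : E → ℂ) x = ∫ x, 𝓕 φ x • u x :=
    integral_congr_ae (by filter_upwards [hu2.coeFn_toLp] with x hx; rw [hx])
  rw [h3]
  have := VectorFourier.integral_fourierIntegral_smul_eq_flip (μ := (volume : Measure E))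
    (ν := (volume : Measure E)) (L := innerₗ E) (f := φ) (g := u)
    Real.continuous_fourierChar (by exact continuous_inner) φ.integrable hu
  rw [flip_innerₗ] at this
  exact this

/-- Plancherel's theorem for the Fourier integral on `L¹ ∩ L²`. -/
theorem eLpNorm_fourier_eq {u : E → ℂ} (hu : Integrable u) (hu2 : MemLp u 2) :
    eLpNorm (𝓕 u) 2 volume = eLpNorm u 2 volume := by
  have h := Lp.norm_fourier_eq (hu2.toLp u)
  rw [Lp.norm_def, Lp.norm_def, ENNReal.toReal_eq_toReal_iff' (Lp.eLpNorm_ne_top _)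
    (Lp.eLpNorm_ne_top _)] at h
  rwa [eLpNorm_congr_ae (fourier_toLp_ae_eq hu hu2), eLpNorm_congr_ae hu2.coeFn_toLp] at h

theorem continuous_fourier {u : E → ℂ} (hu : Integrable u) : Continuous (𝓕 u) :=
  VectorFourier.fourierIntegral_continuous Real.continuous_fourierChar
    (by exact continuous_inner) hu

theorem lintegral_enorm_fourier_sq {u : E → ℂ} (hu : Integrable u) (hu2 : MemLp u 2) :
    ∫⁻ ξ, ‖𝓕 u ξ‖ₑ ^ 2 = ∫⁻ x, ‖u x‖ₑ ^ 2 := by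
  have h := eLpNorm_fourier_eq hu hu2
  rw [eLpNorm_eq_lintegral_rpow_enorm_toReal (by norm_num) (by norm_num),
    eLpNorm_eq_lintegral_rpow_enorm_toReal (by norm_num) (by norm_num)] at h
  refine ENNReal.rpow_left_injective (x := 2⁻¹) (by norm_num) ?_
  simpa using h

theorem fourier_translate_sub {u : E → ℂ} (hu : Integrable u) (h ξ : E) :
    𝓕 (fun x => u (x + h) - u x) ξ = (𝐞 (inner ℝ h ξ) - 1 : ℂ) * 𝓕 u ξ := by
  have h1 : 𝓕 (fun x => u (x + h)) ξ = (𝐞 (inner ℝ h ξ) : ℂ) * 𝓕 u ξ :=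
    congrFun (VectorFourier.fourierIntegral_comp_add_right 𝐞 volume (innerₗ E) u h) ξ
  have h2 : 𝓕 (fun x => u (x + h) - u x) ξ = 𝓕 (fun x => u (x + h)) ξ - 𝓕 u ξ := by
    simp only [Real.fourier_eq, smul_sub]
    refine integral_sub ?_ ?_
    · exact (Real.fourierIntegral_convergent_iff (μ := (volume : Measure E)) ξ).2 (hu.comp_add_right h)
    · exact (Real.fourierIntegral_convergent_iff (μ := (volume : Measure E)) ξ).2 hu
  rw [h2, h1]; ring

theorem lintegral_ball_rpow_norm {a A : ℝ} (hA : 0 < A) :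
    ∫⁻ ξ in Metric.ball (0 : E) A, ENNReal.ofReal (‖ξ‖ ^ (-a)) =
      ENNReal.ofReal (A ^ ((Module.finrank ℝ E : ℝ) - a)) *
        ∫⁻ ξ in Metric.ball (0 : E) 1, ENNReal.ofReal (‖ξ‖ ^ (-a)) := by
  rw [← lintegral_indicator Metric.isOpen_ball.measurableSet,
    ← lintegral_indicator Metric.isOpen_ball.measurableSet]
  set F : E → ℝ≥0∞ := (Metric.ball (0 : E) A).indicator fun ξ => ENNReal.ofReal (‖ξ‖ ^ (-a)) with hF
  set G : E → ℝ≥0∞ := (Metric.ball (0 : E) 1).indicator fun ξ => ENNReal.ofReal (‖ξ‖ ^ (-a)) with hG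
  have h1 : ∀ x, F (A • x) = ENNReal.ofReal (A ^ (-a)) * G x := by
    intro x
    have hn : ‖A • x‖ = A * ‖x‖ := by rw [norm_smul, Real.norm_of_nonneg hA.le]
    by_cases hx : ‖x‖ < 1
    · have hx' : ‖A • x‖ < A := by rw [hn]; nlinarith
      rw [hF, hG, Set.indicator_of_mem (by simpa using hx'), Set.indicator_of_mem (by simpa using hx),
        hn, Real.mul_rpow hA.le (norm_nonneg _), ENNReal.ofReal_mul (by positivity)]
    · have hx' : ¬ ‖A • x‖ < A := by rw [hn]; nlinarith
      rw [hF, hG, Set.indicator_of_notMem (by simpa using hx'),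
        Set.indicator_of_notMem (by simpa using hx), mul_zero]
  have h2 := lintegral_comp_smul_of_pos F hA
  simp only [h1] at h2
  rw [lintegral_const_mul' _ _ ENNReal.ofReal_ne_top] at h2
  have h3 : ENNReal.ofReal (A ^ (Module.finrank ℝ E : ℝ)) *
      ENNReal.ofReal (A ^ (-(Module.finrank ℝ E : ℝ))) = 1 := by
    rw [← ENNReal.ofReal_mul (by positivity), ← Real.rpow_add hA]; simp
  calc ∫⁻ x, F x = ENNReal.ofReal (A ^ (Module.finrank ℝ E : ℝ)) *
        (ENNReal.ofReal (A ^ (-(Module.finrank ℝ E : ℝ))) * ∫⁻ x, F x) := by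
        rw [← mul_assoc, h3, one_mul]
    _ = _ := by
        rw [← h2, ← mul_assoc, ← ENNReal.ofReal_mul (by positivity), ← Real.rpow_add hA,
          ← sub_eq_add_neg]

theorem lintegral_unitBall_rpow_norm_ne_top [Nontrivial E] {a : ℝ}
    (ha : a < Module.finrank ℝ E) :
    ∫⁻ ξ in Metric.ball (0 : E) 1, ENNReal.ofReal (‖ξ‖ ^ (-a)) ≠ ⊤ := by
  have h : IntegrableOn (fun x : E => ‖x‖ ^ (-a)) (Metric.ball (0 : E) 1) volume := by
    rw [integrableOn_fun_norm_addHaar volume (f := fun r : ℝ => r ^ (-a))]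
    have h1 : IntegrableOn (fun y : ℝ => y ^ ((Module.finrank ℝ E : ℝ) - 1 - a)) (Set.Ioo 0 1) :=
      (intervalIntegral.integrableOn_Ioo_rpow_iff one_pos).2 (by linarith)
    refine h1.congr_fun (fun y hy => ?_) measurableSet_Ioo
    have hn : 1 ≤ Module.finrank ℝ E := Module.finrank_pos
    have : ((Module.finrank ℝ E : ℝ) - 1) = ((Module.finrank ℝ E - 1 : ℕ) : ℝ) := by
      push_cast [hn]; ring
    simp only [smul_eq_mul]
    rw [this, sub_eq_add_neg, Real.rpow_add hy.1, Real.rpow_natCast]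
  have h2 := h.lintegral_lt_top
  exact h2.ne

/-- The Fourier symbol of the Gagliardo kernel is a multiple of `‖ξ‖ ^ (2 * s)`. -/
theorem exists_lintegral_gagliardo_symbol [Nontrivial E] {s : ℝ} (hs : s ∈ Set.Ioo (0 : ℝ) 1) :
    ∃ K : ℝ≥0∞, K ≠ 0 ∧ K ≠ ⊤ ∧ ∀ ξ : E,
      ∫⁻ h : E, ENNReal.ofReal (‖h‖ ^ (-((Module.finrank ℝ E : ℝ) + 2 * s))) *
        ‖(𝐞 (inner ℝ h ξ) - 1 : ℂ)‖ₑ ^ 2 = K * ENNReal.ofReal (‖ξ‖ ^ (2 * s)) := by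
  obtain ⟨hs0, hs1⟩ := hs
  set n : ℝ := (Module.finrank ℝ E : ℝ) with hn
  set J : E → ℝ≥0∞ := fun ξ => ∫⁻ h : E, ENNReal.ofReal (‖h‖ ^ (-(n + 2 * s))) *
        ‖(𝐞 (inner ℝ h ξ) - 1 : ℂ)‖ₑ ^ 2 with hJ
  have hn1 : 1 ≤ n := by rw [hn]; exact_mod_cast (Module.finrank_pos : 0 < Module.finrank ℝ E)
  have hcont : ∀ ξ : E, Continuous fun h : E => (𝐞 (inner ℝ h ξ) - 1 : ℂ) := fun ξ => by
    have := Real.continuous_fourierChar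
    fun_prop
  have hrot : ∀ ξ η : E, ‖ξ‖ = ‖η‖ → J ξ = J η := by
    intro ξ η h
    set T := (ℝ ∙ (ξ - η))ᗮ.reflection
    have hT : T ξ = η := Submodule.reflection_sub h
    have h1 := T.measurePreserving.lintegral_comp_emb T.toMeasurableEquiv.measurableEmbedding
      (fun h : E => ENNReal.ofReal (‖h‖ ^ (-(n + 2 * s))) * ‖(𝐞 (inner ℝ h η) - 1 : ℂ)‖ₑ ^ 2)
    rw [hJ]
    simp only
    rw [← h1]
    refine lintegral_congr fun x => ?_
    rw [T.norm_map, ← hT, T.inner_map_map]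
  have hscale : ∀ (R : ℝ) (ξ : E), 0 < R → J (R • ξ) = ENNReal.ofReal (R ^ (2 * s)) * J ξ := by
    intro R ξ hR
    have h1 := lintegral_comp_smul_of_pos (fun h : E => ENNReal.ofReal (‖h‖ ^ (-(n + 2 * s))) *
      ‖(𝐞 (inner ℝ h ξ) - 1 : ℂ)‖ₑ ^ 2) hR
    have h2 : J (R • ξ) = ENNReal.ofReal (R ^ (n + 2 * s)) * ∫⁻ h : E,
        ENNReal.ofReal (‖R • h‖ ^ (-(n + 2 * s))) * ‖(𝐞 (inner ℝ (R • h) ξ) - 1 : ℂ)‖ₑ ^ 2 := by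
      rw [← lintegral_const_mul' _ _ ENNReal.ofReal_ne_top]
      refine lintegral_congr fun x => ?_
      rw [real_inner_smul_left, real_inner_smul_right, ← mul_assoc,
        ← ENNReal.ofReal_mul (by positivity), norm_smul, Real.norm_of_nonneg hR.le,
        Real.mul_rpow hR.le (norm_nonneg _), ← mul_assoc, ← Real.rpow_add hR]
      simp
    rw [h2, h1, ← mul_assoc, ← ENNReal.ofReal_mul (by positivity), ← Real.rpow_add hR]
    congr 3
    ring
  obtain ⟨e, he⟩ := exists_norm_eq E zero_le_one
  refine ⟨J e, ?_, ?_, ?_⟩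
  · intro h0
    rw [hJ] at h0
    simp only at h0
    have hmeas : Measurable fun h : E => ENNReal.ofReal (‖h‖ ^ (-(n + 2 * s))) *
        ‖(𝐞 (inner ℝ h e) - 1 : ℂ)‖ₑ ^ 2 := by
      have := (hcont e).measurable
      fun_prop
    rw [lintegral_eq_zero_iff hmeas] at h0
    set U : Set E := {h : E | h ≠ 0 ∧ (𝐞 (inner ℝ h e) - 1 : ℂ) ≠ 0}
    have hU : IsOpen U := isOpen_ne.inter (isOpen_ne.preimage (hcont e))
    have hne : U.Nonempty := by
      refine ⟨(2⁻¹ : ℝ) • e, ?_, ?_⟩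
      · have : e ≠ 0 := by intro h; simp [h] at he
        simpa using this
      · rw [real_inner_smul_left, real_inner_self_eq_norm_sq, he, Real.fourierChar_apply]
        have : (2 * Real.pi * (2⁻¹ * 1 ^ 2) : ℝ) = Real.pi := by ring
        rw [this, Complex.exp_pi_mul_I]
        norm_num
    have hpos := hU.measure_pos volume hne
    refine hpos.ne' (measure_mono_null ?_ h0)
    rintro x ⟨hx0, hx1⟩
    have : 0 < ‖x‖ ^ (-(n + 2 * s)) := Real.rpow_pos_of_pos (norm_pos_iff.2 hx0) _
    simp only [Set.mem_compl_iff, Set.mem_ofPred_eq, Pi.zero_apply, mul_eq_zero, not_or]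
    exact ⟨(ENNReal.ofReal_pos.2 this).ne', by simpa using hx1⟩
  · set g : ℝ → ℝ := fun r => if r < 1 then (2 * Real.pi) ^ 2 * r ^ (2 - (n + 2 * s))
      else 4 * r ^ (-(n + 2 * s)) with hg
    have hgi : Integrable (fun x : E => g ‖x‖) := by
      rw [integrable_fun_norm_addHaar, ← Set.Ioo_union_Ici_eq_Ioi one_pos]
      have hn' : n - 1 = ((Module.finrank ℝ E - 1 : ℕ) : ℝ) := by
        push_cast [(Module.finrank_pos : 1 ≤ Module.finrank ℝ E)]; rw [hn]
      refine IntegrableOn.union ?_ ?_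
      · have h1 : IntegrableOn (fun y : ℝ => (2 * Real.pi) ^ 2 * y ^ (1 - 2 * s)) (Set.Ioo 0 1) :=
          ((intervalIntegral.integrableOn_Ioo_rpow_iff one_pos).2 (by linarith)).const_mul _
        refine h1.congr_fun (fun y hy => ?_) measurableSet_Ioo
        simp only [hg, if_pos hy.2, smul_eq_mul]
        rw [← Real.rpow_natCast y, ← hn', mul_left_comm, ← Real.rpow_add hy.1]
        ring_nf
      · have h1 : IntegrableOn (fun y : ℝ => 4 * y ^ (-1 - 2 * s)) (Set.Ici 1) := by
          rw [integrableOn_Ici_iff_integrableOn_Ioi]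
          exact (integrableOn_Ioi_rpow_of_lt (by linarith) one_pos).const_mul _
        refine h1.congr_fun (fun y hy => ?_) measurableSet_Ici
        have hy1 : (1 : ℝ) ≤ y := hy
        simp only [hg, if_neg (not_lt.2 hy1), smul_eq_mul]
        rw [← Real.rpow_natCast y, ← hn', mul_left_comm, ← Real.rpow_add (by linarith)]
        ring_nf
    refine ne_top_of_le_ne_top hgi.lintegral_lt_top.ne (lintegral_mono fun x => ?_)
    have he2 : ‖(𝐞 (inner ℝ x e) - 1 : ℂ)‖ₑ ^ 2 =
        ENNReal.ofReal (‖(𝐞 (inner ℝ x e) - 1 : ℂ)‖ ^ 2) := by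
      rw [ENNReal.ofReal_pow (norm_nonneg _), ofReal_norm]
    rw [he2, ← ENNReal.ofReal_mul (by positivity)]
    refine ENNReal.ofReal_le_ofReal ?_
    simp only [hg]
    split_ifs with hx
    · rcases (norm_nonneg x).eq_or_lt with h0 | hpos
      · rw [← h0, Real.zero_rpow (by linarith)]
        have : (0 : ℝ) ≤ 0 ^ (2 - (n + 2 * s)) := Real.rpow_nonneg le_rfl _
        rw [zero_mul]; positivity
      · have h1 : ‖(𝐞 (inner ℝ x e) - 1 : ℂ)‖ ≤ 2 * Real.pi * ‖x‖ := by
          rw [Real.fourierChar_apply, mul_comm]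
          refine (Real.norm_exp_I_mul_ofReal_sub_one_le).trans ?_
          rw [norm_mul, Real.norm_of_nonneg (by positivity)]
          gcongr
          simpa [he] using norm_inner_le_norm (𝕜 := ℝ) x e
        have h2 : ‖(𝐞 (inner ℝ x e) - 1 : ℂ)‖ ^ 2 ≤ (2 * Real.pi * ‖x‖) ^ 2 := by gcongr
        have h3 : ‖x‖ ^ (2 - (n + 2 * s)) = ‖x‖ ^ (-(n + 2 * s)) * ‖x‖ ^ 2 := by
          rw [sub_eq_neg_add, Real.rpow_add hpos]; norm_num
        rw [h3]
        calc _ ≤ ‖x‖ ^ (-(n + 2 * s)) * (2 * Real.pi * ‖x‖) ^ 2 := by gcongr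
          _ = _ := by ring
    · have h1 : ‖(𝐞 (inner ℝ x e) - 1 : ℂ)‖ ≤ 2 := by
        refine (norm_sub_le _ _).trans ?_
        rw [Circle.norm_coe, norm_one]
        norm_num
      have h2 : ‖(𝐞 (inner ℝ x e) - 1 : ℂ)‖ ^ 2 ≤ 2 ^ 2 := by gcongr
      calc _ ≤ ‖x‖ ^ (-(n + 2 * s)) * 2 ^ 2 := by gcongr
        _ = _ := by ring
  · intro ξ
    rcases eq_or_ne ξ 0 with rfl | hξ
    · simp [hs0.ne']
    · have hpos := norm_pos_iff.2 hξ
      have h1 := hrot ξ (‖ξ‖ • e) (by simp [norm_smul, he])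
      rw [hscale _ _ hpos, mul_comm] at h1
      exact h1

theorem enorm_fourier_le_lintegral (F : E → ℂ) (x : E) : ‖𝓕 F x‖ₑ ≤ ∫⁻ ξ, ‖F ξ‖ₑ := by
  rw [Real.fourier_eq]
  refine (enorm_integral_le_lintegral_enorm _).trans_eq (lintegral_congr fun ξ => ?_)
  rw [Circle.smul_def, enorm_smul, ← ofReal_norm, Circle.norm_coe]
  simp

/-- Cauchy–Schwarz bound for the `L¹` norm over a ball by a homogeneous weighted `L²` norm. -/
theorem lintegral_ball_enorm_le [Nontrivial E] {F : E → ℂ} (hF : AEStronglyMeasurable F) (σ : ℝ)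
    {A : ℝ} (hA : 0 < A) :
    ∫⁻ ξ in Metric.ball (0 : E) A, ‖F ξ‖ₑ ≤
      (ENNReal.ofReal (A ^ ((Module.finrank ℝ E : ℝ) - 2 * σ)) *
        ∫⁻ ξ in Metric.ball (0 : E) 1, ENNReal.ofReal (‖ξ‖ ^ (-(2 * σ)))) ^ (1 / 2 : ℝ) *
      (∫⁻ ξ, ENNReal.ofReal (‖ξ‖ ^ (2 * σ)) * ‖F ξ‖ₑ ^ 2) ^ (1 / 2 : ℝ) := by
  set f : E → ℝ≥0∞ := fun ξ => ENNReal.ofReal (‖ξ‖ ^ (-σ)) with hf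
  set g : E → ℝ≥0∞ := fun ξ => ENNReal.ofReal (‖ξ‖ ^ σ) * ‖F ξ‖ₑ with hg
  have hfm : Measurable f := by fun_prop
  have hgm : AEMeasurable g := by
    have := hF.enorm
    fun_prop
  have hcs := ENNReal.lintegral_mul_le_Lp_mul_Lq (volume.restrict (Metric.ball (0 : E) A))
    Real.HolderConjugate.two_two hfm.aemeasurable hgm.restrict
  have h1 : ∫⁻ ξ in Metric.ball (0 : E) A, ‖F ξ‖ₑ =
      ∫⁻ ξ in Metric.ball (0 : E) A, (f * g) ξ := by
    refine lintegral_congr_ae (ae_restrict_of_ae ?_)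
    filter_upwards [compl_mem_ae_iff.2 (measure_singleton (μ := (volume : Measure E)) 0)] with ξ hξ
    have hpos : 0 < ‖ξ‖ := norm_pos_iff.2 hξ
    simp only [hf, hg, Pi.mul_apply]
    rw [← mul_assoc, ← ENNReal.ofReal_mul (by positivity), ← Real.rpow_add hpos]
    simp
  have h2 : ∀ ξ, f ξ ^ (2 : ℝ) = ENNReal.ofReal (‖ξ‖ ^ (-(2 * σ))) := fun ξ => by
    simp only [hf]
    rw [ENNReal.ofReal_rpow_of_nonneg (by positivity) (by norm_num), ← Real.rpow_mul (norm_nonneg _)]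
    ring_nf
  have h3 : ∀ ξ, g ξ ^ (2 : ℝ) = ENNReal.ofReal (‖ξ‖ ^ (2 * σ)) * ‖F ξ‖ₑ ^ 2 := fun ξ => by
    simp only [hg]
    rw [ENNReal.mul_rpow_of_nonneg _ _ (by norm_num),
      ENNReal.ofReal_rpow_of_nonneg (by positivity) (by norm_num), ← Real.rpow_mul (norm_nonneg _),
      ENNReal.rpow_two]
    ring_nf
  simp only [h2, h3] at hcs
  rw [lintegral_ball_rpow_norm hA] at hcs
  rw [h1]
  refine hcs.trans ?_
  gcongr
  exact Measure.restrict_le_self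

/-- Splitting frequencies at radius `A` controls the distribution function of `𝓕 F`. -/
theorem volume_le_norm_fourier_le {F : E → ℂ} (hF : Integrable F) (hF2 : MemLp F 2) {A t : ℝ}
    (ht : 0 < t)
    (hlow : ∫⁻ ξ in Metric.ball (0 : E) A, ‖F ξ‖ₑ ≤ ENNReal.ofReal (t / 2)) :
    volume {x | t ≤ ‖𝓕 F x‖} ≤
      ENNReal.ofReal (4 / t ^ 2) * ∫⁻ ξ in (Metric.ball (0 : E) A)ᶜ, ‖F ξ‖ₑ ^ 2 := by
  have hB : MeasurableSet (Metric.ball (0 : E) A) := Metric.isOpen_ball.measurableSet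
  set F₁ := (Metric.ball (0 : E) A).indicator F with hF₁
  set F₂ := (Metric.ball (0 : E) A)ᶜ.indicator F with hF₂
  have hi₁ : Integrable F₁ := hF.indicator hB
  have hi₂ : Integrable F₂ := hF.indicator hB.compl
  have hadd : ∀ x, 𝓕 F x = 𝓕 F₁ x + 𝓕 F₂ x := by
    intro x
    have hsum : F = fun ξ => F₁ ξ + F₂ ξ := (Set.indicator_self_add_compl _ F).symm
    conv_lhs => rw [hsum]
    simp only [Real.fourier_eq, smul_add]
    refine integral_add ?_ ?_
    · exact (Real.fourierIntegral_convergent_iff (μ := (volume : Measure E)) x).2 hi₁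
    · exact (Real.fourierIntegral_convergent_iff (μ := (volume : Measure E)) x).2 hi₂
  have h₁ : ∀ x, ‖𝓕 F₁ x‖ ≤ t / 2 := by
    intro x
    have h := (enorm_fourier_le_lintegral F₁ x).trans_eq (by
      simp only [hF₁, enorm_indicator_eq_indicator_enorm]
      exact lintegral_indicator hB _)
    have h' := h.trans hlow
    rwa [← ofReal_norm, ENNReal.ofReal_le_ofReal_iff (by positivity)] at h'
  have hsub : {x | t ≤ ‖𝓕 F x‖} ⊆ {x | ENNReal.ofReal (t ^ 2 / 4) ≤ ‖𝓕 F₂ x‖ₑ ^ 2} := by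
    intro x hx
    have hx' : t ≤ ‖𝓕 F x‖ := hx
    rw [hadd] at hx'
    have h2 : t / 2 ≤ ‖𝓕 F₂ x‖ := by linarith [norm_add_le (𝓕 F₁ x) (𝓕 F₂ x), h₁ x]
    rw [Set.mem_ofPred_eq, ← ofReal_norm, ← ENNReal.ofReal_pow (norm_nonneg _)]
    refine ENNReal.ofReal_le_ofReal ?_
    nlinarith
  have hmark := mul_meas_ge_le_lintegral (μ := (volume : Measure E))
    (f := fun x => ‖𝓕 F₂ x‖ₑ ^ 2) (by have := (continuous_fourier hi₂).measurable; fun_prop)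
    (ENNReal.ofReal (t ^ 2 / 4))
  rw [lintegral_enorm_fourier_sq hi₂ (hF2.indicator hB.compl)] at hmark
  have h4 : ∫⁻ ξ, ‖F₂ ξ‖ₑ ^ 2 = ∫⁻ ξ in (Metric.ball (0 : E) A)ᶜ, ‖F ξ‖ₑ ^ 2 := by
    rw [← lintegral_indicator hB.compl]
    refine lintegral_congr fun ξ => ?_
    by_cases h : ξ ∈ (Metric.ball (0 : E) A)ᶜ <;> simp [hF₂, h]
  rw [h4] at hmark
  calc volume {x | t ≤ ‖𝓕 F x‖}
      = ENNReal.ofReal (4 / t ^ 2) * (ENNReal.ofReal (t ^ 2 / 4) * volume {x | t ≤ ‖𝓕 F x‖}) := by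
        rw [← mul_assoc, ← ENNReal.ofReal_mul (by positivity)]
        have : 4 / t ^ 2 * (t ^ 2 / 4) = 1 := by field_simp
        rw [this]; simp
    _ ≤ _ := by
        gcongr
        exact (by gcongr : _ ≤ _).trans hmark

theorem lintegral_Ioc_ofReal_rpow {r Λ : ℝ} (hr : -1 < r) (hΛ : 0 ≤ Λ) :
    ∫⁻ t in Set.Ioc 0 Λ, ENNReal.ofReal (t ^ r) = ENNReal.ofReal (Λ ^ (r + 1) / (r + 1)) := by
  have hi : IntegrableOn (fun t : ℝ => t ^ r) (Set.Ioc 0 Λ) := by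
    rw [← intervalIntegrable_iff_integrableOn_Ioc_of_le hΛ]
    exact intervalIntegral.intervalIntegrable_rpow' hr
  rw [← ofReal_integral_eq_lintegral_ofReal hi, ← intervalIntegral.integral_of_le hΛ,
    integral_rpow (Or.inl hr), Real.zero_rpow (by linarith), sub_zero]
  filter_upwards [ae_restrict_mem measurableSet_Ioc] with t ht
  exact Real.rpow_nonneg ht.1.le _

/-- Homogeneous Sobolev embedding `Ḣ^σ ⊂ L^q`, written on the Fourier side. -/
theorem exists_lintegral_fourier_rpow_le [Nontrivial E] {σ q : ℝ} (hq : 2 < q)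
    (hσ : σ = (Module.finrank ℝ E : ℝ) * (1 / 2 - 1 / q)) :
    ∃ C : ℝ, 0 < C ∧ ∀ F : E → ℂ, Integrable F → MemLp F 2 →
      ∫⁻ x, ‖𝓕 F x‖ₑ ^ q ≤
        ENNReal.ofReal C * (∫⁻ ξ, ENNReal.ofReal (‖ξ‖ ^ (2 * σ)) * ‖F ξ‖ₑ ^ 2) ^ (q / 2) := by
  set n : ℝ := (Module.finrank ℝ E : ℝ) with hn
  have hn1 : 1 ≤ n := by rw [hn]; exact_mod_cast (Module.finrank_pos : 0 < Module.finrank ℝ E)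
  have hq0 : 0 < q := by linarith
  have hn2 : n - 2 * σ = 2 * (n / q) := by rw [hσ]; field_simp; ring
  have hnq : 0 < n / q := by positivity
  set c := ∫⁻ ξ in Metric.ball (0 : E) 1, ENNReal.ofReal (‖ξ‖ ^ (-(2 * σ))) with hc
  have hctop : c ≠ ⊤ := lintegral_unitBall_rpow_norm_ne_top (by rw [← hn]; linarith)
  set κ := 2 * Real.sqrt c.toReal + 1 with hκ
  have hκ0 : 0 < κ := by positivity
  refine ⟨q * (4 / (q - 2)) * κ ^ (q - 2), by
    have : 0 < q - 2 := by linarith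
    positivity, fun F hF hF2 => ?_⟩
  have hC0 : 0 < q * (4 / (q - 2)) * κ ^ (q - 2) := by
    have : 0 < q - 2 := by linarith
    positivity
  set M := ∫⁻ ξ, ENNReal.ofReal (‖ξ‖ ^ (2 * σ)) * ‖F ξ‖ₑ ^ 2 with hM
  have hFm : AEMeasurable fun ξ => ‖F ξ‖ₑ ^ 2 := by have := hF.1.enorm; fun_prop
  have main : ∀ m : ℝ, 0 < m → M ≤ ENNReal.ofReal (m ^ 2) → ∫⁻ x, ‖𝓕 F x‖ₑ ^ q ≤
      ENNReal.ofReal (q * (4 / (q - 2)) * κ ^ (q - 2)) * (ENNReal.ofReal (m ^ (q - 2)) * M) := by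
    intro m hm hMm
    have hlevel : ∀ t : ℝ, 0 < t → volume {x | t ≤ ‖𝓕 F x‖} * ENNReal.ofReal (t ^ (q - 1)) ≤
        ∫⁻ ξ, {p : ℝ × E | p.1 ≤ κ * m * ‖p.2‖ ^ (n / q)}.indicator
          (fun p => ENNReal.ofReal (4 * p.1 ^ (q - 3)) * ‖F p.2‖ₑ ^ 2) (t, ξ) := by
      intro t ht
      set A := (t / (κ * m)) ^ (q / n) with hA
      have hA0 : 0 < A := by positivity
      have hAn : A ^ (n / q) = t / (κ * m) := by
        rw [hA, ← Real.rpow_mul (by positivity)]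
        have : q / n * (n / q) = 1 := by field_simp
        rw [this, Real.rpow_one]
      have hlow : ∫⁻ ξ in Metric.ball (0 : E) A, ‖F ξ‖ₑ ≤ ENNReal.ofReal (t / 2) := by
        refine (lintegral_ball_enorm_le hF.1 σ hA0).trans ?_
        rw [← hn, ← hc, ← hM, hn2, two_mul, Real.rpow_add hA0, hAn, ← ENNReal.ofReal_toReal hctop,
          ← ENNReal.ofReal_mul (by positivity)]
        calc _ ≤ ENNReal.ofReal (t / (κ * m) * (t / (κ * m)) * c.toReal) ^ (1 / 2 : ℝ) *
              ENNReal.ofReal (m ^ 2) ^ (1 / 2 : ℝ) := by gcongr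
          _ = ENNReal.ofReal (t / κ * Real.sqrt c.toReal) := by
            rw [ENNReal.ofReal_rpow_of_nonneg (by positivity) (by norm_num),
              ENNReal.ofReal_rpow_of_nonneg (by positivity) (by norm_num),
              ← ENNReal.ofReal_mul (by positivity), ← Real.sqrt_eq_rpow, ← Real.sqrt_eq_rpow,
              Real.sqrt_mul (by positivity), Real.sqrt_mul_self (by positivity),
              Real.sqrt_sq hm.le]
            congr 1
            field_simp
          _ ≤ _ := by
            refine ENNReal.ofReal_le_ofReal ?_
            rw [div_mul_eq_mul_div, div_le_div_iff₀ hκ0 two_pos]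
            have := Real.sqrt_nonneg c.toReal
            rw [hκ]
            nlinarith
      have hvol := volume_le_norm_fourier_le hF hF2 ht hlow
      calc _ ≤ ENNReal.ofReal (4 / t ^ 2) * (∫⁻ ξ in (Metric.ball (0 : E) A)ᶜ, ‖F ξ‖ₑ ^ 2) *
            ENNReal.ofReal (t ^ (q - 1)) := by gcongr
        _ = ENNReal.ofReal (4 * t ^ (q - 3)) * ∫⁻ ξ in (Metric.ball (0 : E) A)ᶜ, ‖F ξ‖ₑ ^ 2 := by
          rw [mul_right_comm, ← ENNReal.ofReal_mul (by positivity)]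
          have : t ^ (q - 1) = t ^ (q - 3) * t ^ 2 := by
            rw [← Real.rpow_natCast, ← Real.rpow_add ht]; congr 1; push_cast; ring
          rw [this]
          congr 2
          field_simp
        _ = _ := by
          rw [← lintegral_indicator Metric.isOpen_ball.measurableSet.compl,
            ← lintegral_const_mul' _ _ ENNReal.ofReal_ne_top]
          refine lintegral_congr fun ξ => ?_
          have hiff : ξ ∈ (Metric.ball (0 : E) A)ᶜ ↔
              (t, ξ) ∈ {p : ℝ × E | p.1 ≤ κ * m * ‖p.2‖ ^ (n / q)} := by
            have h1 : A ≤ ‖ξ‖ ↔ A ^ (n / q) ≤ ‖ξ‖ ^ (n / q) :=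
              (Real.rpow_le_rpow_iff hA0.le (norm_nonneg _) hnq).symm
            simp only [Set.mem_compl_iff, mem_ball_zero_iff, not_lt, Set.mem_ofPred_eq]
            rw [h1, hAn, div_le_iff₀' (by positivity)]
          by_cases h : ξ ∈ (Metric.ball (0 : E) A)ᶜ
          · rw [Set.indicator_of_mem h, Set.indicator_of_mem (hiff.1 h)]
          · rw [Set.indicator_of_notMem h, Set.indicator_of_notMem (hiff.not.1 h), mul_zero]
    have hcontF := continuous_fourier hF
    have hlayer := lintegral_rpow_eq_lintegral_meas_le_mul (volume : Measure E)
      (f := fun x => ‖𝓕 F x‖) (Filter.Eventually.of_forall fun x => norm_nonneg _)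
      hcontF.norm.measurable.aemeasurable hq0
    have hleft : ∫⁻ x, ‖𝓕 F x‖ₑ ^ q = ∫⁻ x, ENNReal.ofReal (‖𝓕 F x‖ ^ q) :=
      lintegral_congr fun x => by
        rw [← ofReal_norm, ENNReal.ofReal_rpow_of_nonneg (norm_nonneg _) hq0.le]
    have hinner : ∀ ξ : E, ∫⁻ t in Set.Ioi (0 : ℝ),
        {p : ℝ × E | p.1 ≤ κ * m * ‖p.2‖ ^ (n / q)}.indicator
          (fun p => ENNReal.ofReal (4 * p.1 ^ (q - 3)) * ‖F p.2‖ₑ ^ 2) (t, ξ) =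
        ENNReal.ofReal (4 / (q - 2) * (κ * m) ^ (q - 2)) *
          (ENNReal.ofReal (‖ξ‖ ^ (2 * σ)) * ‖F ξ‖ₑ ^ 2) := by
      intro ξ
      set Λ := κ * m * ‖ξ‖ ^ (n / q) with hΛ
      have hΛ0 : 0 ≤ Λ := by positivity
      have e1 : ∀ t : ℝ, {p : ℝ × E | p.1 ≤ κ * m * ‖p.2‖ ^ (n / q)}.indicator
          (fun p => ENNReal.ofReal (4 * p.1 ^ (q - 3)) * ‖F p.2‖ₑ ^ 2) (t, ξ) =
          (Set.Iic Λ).indicator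
            (fun t => ENNReal.ofReal 4 * ‖F ξ‖ₑ ^ 2 * ENNReal.ofReal (t ^ (q - 3))) t := by
        intro t
        by_cases h : t ≤ Λ
        · rw [Set.indicator_of_mem (by exact h), Set.indicator_of_mem (by exact h),
            ENNReal.ofReal_mul (by norm_num)]
          ring
        · rw [Set.indicator_of_notMem (by exact h), Set.indicator_of_notMem (by exact h)]
      simp only [e1]
      rw [lintegral_indicator measurableSet_Iic, Measure.restrict_restrict measurableSet_Iic,
        Set.inter_comm, Set.Ioi_inter_Iic, lintegral_const_mul _ (by fun_prop),
        lintegral_Ioc_ofReal_rpow (by linarith) hΛ0]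
      have e2 : q - 3 + 1 = q - 2 := by ring
      have e3 : Λ ^ (q - 2) = (κ * m) ^ (q - 2) * ‖ξ‖ ^ (2 * σ) := by
        rw [hΛ, Real.mul_rpow (by positivity) (by positivity), ← Real.rpow_mul (norm_nonneg _)]
        congr 2
        rw [hσ]; field_simp
      have hq2 : 0 ≤ q - 2 := by linarith
      rw [e2, mul_right_comm, ← ENNReal.ofReal_mul (by norm_num), ← mul_assoc,
        ← ENNReal.ofReal_mul (by positivity), e3]
      congr 2
      ring
    have hmeas : AEMeasurable (Function.uncurry fun (t : ℝ) (ξ : E) =>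
        {p : ℝ × E | p.1 ≤ κ * m * ‖p.2‖ ^ (n / q)}.indicator
          (fun p => ENNReal.ofReal (4 * p.1 ^ (q - 3)) * ‖F p.2‖ₑ ^ 2) (t, ξ))
        ((volume.restrict (Set.Ioi (0 : ℝ))).prod (volume : Measure E)) := by
      refine AEMeasurable.indicator ?_ (measurableSet_le (by fun_prop) (by fun_prop))
      have h2 : AEMeasurable (fun p : ℝ × E => ‖F p.2‖ₑ ^ 2)
        ((volume.restrict (Set.Ioi (0 : ℝ))).prod (volume : Measure E)) := hFm.comp_snd
      fun_prop
    rw [hleft, hlayer]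
    calc _ ≤ ENNReal.ofReal q * ∫⁻ t in Set.Ioi (0 : ℝ), ∫⁻ ξ,
          {p : ℝ × E | p.1 ≤ κ * m * ‖p.2‖ ^ (n / q)}.indicator
          (fun p => ENNReal.ofReal (4 * p.1 ^ (q - 3)) * ‖F p.2‖ₑ ^ 2) (t, ξ) := by
          gcongr 1
          exact setLIntegral_mono' measurableSet_Ioi hlevel
      _ = ENNReal.ofReal q * (ENNReal.ofReal (4 / (q - 2) * (κ * m) ^ (q - 2)) * M) := by
          rw [lintegral_lintegral_swap hmeas]
          simp only [hinner]
          rw [lintegral_const_mul' _ _ ENNReal.ofReal_ne_top]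
      _ = _ := by
          have hq2 : 0 < q - 2 := by linarith
          rw [← mul_assoc, ← ENNReal.ofReal_mul hq0.le,
            ← mul_assoc (ENNReal.ofReal (q * (4 / (q - 2)) * κ ^ (q - 2))),
            ← ENNReal.ofReal_mul hC0.le, Real.mul_rpow hκ0.le hm.le]
          congr 2
          ring
  rcases eq_or_ne M 0 with h0 | h0
  · refine (main 1 one_pos (by simp [h0])).trans ?_
    simp [h0]
  rcases eq_or_ne M ⊤ with ht | ht
  · rw [ht, ENNReal.top_rpow_of_pos (by positivity), ENNReal.mul_top (ENNReal.ofReal_pos.2 hC0).ne']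
    exact le_top
  have hMpos : 0 < M.toReal := ENNReal.toReal_pos h0 ht
  have hMeq : ENNReal.ofReal M.toReal = M := ENNReal.ofReal_toReal ht
  refine (main (Real.sqrt M.toReal) (Real.sqrt_pos.2 hMpos) ?_).trans_eq ?_
  · rw [Real.sq_sqrt hMpos.le, hMeq]
  · congr 1
    rw [← hMeq, ENNReal.toReal_ofReal hMpos.le, ENNReal.ofReal_rpow_of_pos hMpos,
      ← ENNReal.ofReal_mul (by positivity), Real.sqrt_eq_rpow, ← Real.rpow_mul hMpos.le,
      ← Real.rpow_add_one hMpos.ne']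
    congr 2
    ring

theorem lintegral_translate_sub_rpow_le {q σ C : ℝ}
    (hC : ∀ F : E → ℂ, Integrable F → MemLp F 2 → ∫⁻ x, ‖𝓕 F x‖ₑ ^ q ≤
      ENNReal.ofReal C * (∫⁻ ξ, ENNReal.ofReal (‖ξ‖ ^ (2 * σ)) * ‖F ξ‖ₑ ^ 2) ^ (q / 2))
    {u : E → ℂ} (hc : Continuous u) (hu : Integrable u) (hFu : Integrable (𝓕 u))
    (hFu2 : MemLp (𝓕 u) 2) (h : E) :
    ∫⁻ x, ‖u (x + h) - u x‖ₑ ^ q ≤ ENNReal.ofReal C * (∫⁻ ξ, ENNReal.ofReal (‖ξ‖ ^ (2 * σ)) *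
      (‖(𝐞 (inner ℝ h ξ) - 1 : ℂ)‖ₑ ^ 2 * ‖𝓕 u ξ‖ₑ ^ 2)) ^ (q / 2) := by
  set D : E → ℂ := fun x => u (x + h) - u x with hD
  have hDc : Continuous D := by fun_prop
  have hDi : Integrable D := (hu.comp_add_right h).sub hu
  have hFD : 𝓕 D = fun ξ => (𝐞 (inner ℝ h ξ) - 1 : ℂ) * 𝓕 u ξ :=
    funext fun ξ => fourier_translate_sub hu h ξ
  have hbd : ∀ ξ, ‖𝓕 D ξ‖ ≤ 2 * ‖𝓕 u ξ‖ := fun ξ => by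
    rw [hFD, norm_mul]
    gcongr
    refine (norm_sub_le _ _).trans ?_
    rw [Circle.norm_coe, norm_one]; norm_num
  have hmeas : AEStronglyMeasurable (𝓕 D) (volume : Measure E) :=
    (continuous_fourier hDi).aestronglyMeasurable
  have hFDi : Integrable (𝓕 D) :=
    (hFu.norm.const_mul 2).mono' hmeas (Filter.Eventually.of_forall hbd)
  have hFD2 : MemLp (𝓕 D) 2 := hFu2.of_le_mul hmeas (Filter.Eventually.of_forall hbd)
  have hinv : ∀ x, D x = 𝓕 (𝓕 D) (-x) := fun x => by
    rw [← Real.fourierInv_eq_fourier_neg, hDc.fourierInv_fourier_eq hDi hFDi]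
  calc ∫⁻ x, ‖D x‖ₑ ^ q = ∫⁻ x, ‖𝓕 (𝓕 D) (-x)‖ₑ ^ q := by simp only [hinv]
    _ = ∫⁻ x, ‖𝓕 (𝓕 D) x‖ₑ ^ q := lintegral_neg_eq_self (μ := volume) fun x => ‖𝓕 (𝓕 D) x‖ₑ ^ q
    _ ≤ _ := hC _ hFDi hFD2
    _ = _ := by simp only [hFD, enorm_mul, mul_pow]

theorem lintegral_mul_lintegral_mul_eq {X Y : Type*} [MeasurableSpace X] [MeasurableSpace Y]
    {μ : Measure X} {ν : Measure Y} [SFinite μ] [SFinite ν] {K : ℝ≥0∞} {k : X → ℝ≥0∞}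
    {m : X → Y → ℝ≥0∞} {w v : Y → ℝ≥0∞} (hk : Measurable k) (hm : Measurable (Function.uncurry m))
    (hw : Measurable w) (hv : Measurable v) (hK : ∀ y, ∫⁻ x, k x * m x y ∂μ = K * w y) :
    ∫⁻ x, k x * ∫⁻ y, m x y * v y ∂ν ∂μ = K * ∫⁻ y, w y * v y ∂ν := by
  have hkm : Measurable (Function.uncurry fun x y => k x * (m x y * v y)) :=
    (hk.comp measurable_fst).mul (hm.mul (hv.comp measurable_snd))
  calc ∫⁻ x, k x * ∫⁻ y, m x y * v y ∂ν ∂μ = ∫⁻ x, ∫⁻ y, k x * (m x y * v y) ∂ν ∂μ :=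
        lintegral_congr fun x =>
          (lintegral_const_mul _ ((hm.comp measurable_prodMk_left).mul hv)).symm
    _ = ∫⁻ y, ∫⁻ x, k x * (m x y * v y) ∂μ ∂ν := lintegral_lintegral_swap hkm.aemeasurable
    _ = ∫⁻ y, K * (w y * v y) ∂ν := by
        refine lintegral_congr fun y => ?_
        have h1 : Measurable fun x => k x * m x y := hk.mul (hm.comp measurable_prodMk_right)
        rw [← mul_assoc, ← hK, ← lintegral_mul_const _ h1]
        simp only [mul_assoc]
    _ = _ := lintegral_const_mul _ (hw.mul hv)

theorem measurable_enorm_fourierChar_inner_sub_one_sq :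
    Measurable (Function.uncurry fun h ξ : E => ‖(𝐞 (inner ℝ h ξ) - 1 : ℂ)‖ₑ ^ 2) := by
  have : Continuous fun p : E × E => (𝐞 (inner ℝ p.1 p.2) - 1 : ℂ) := by fun_prop
  exact this.enorm.measurable.pow_const 2

theorem lintegral_gagliardo_eq {s : ℝ} {K : ℝ≥0∞} {k : E → ℝ≥0∞} (hk : Measurable k)
    (hK : ∀ ξ : E, ∫⁻ h : E, k h * ‖(𝐞 (inner ℝ h ξ) - 1 : ℂ)‖ₑ ^ 2 =
      K * ENNReal.ofReal (‖ξ‖ ^ (2 * s)))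
    {u : E → ℂ} (hu : Integrable u) (hu2 : MemLp u 2) :
    ∫⁻ h, k h * ∫⁻ x, ‖u (x + h) - u x‖ₑ ^ 2 =
      K * ∫⁻ ξ, ENNReal.ofReal (‖ξ‖ ^ (2 * s)) * ‖𝓕 u ξ‖ₑ ^ 2 := by
  rw [← lintegral_mul_lintegral_mul_eq hk measurable_enorm_fourierChar_inner_sub_one_sq
    (by fun_prop) ((continuous_fourier hu).enorm.measurable.pow_const 2) hK]
  refine lintegral_congr fun h => ?_
  have hshift : MemLp (fun x => u (x + h)) 2 volume :=
    hu2.comp_measurePreserving (measurePreserving_add_right volume h)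
  have hpl := lintegral_enorm_fourier_sq ((hu.comp_add_right h).sub hu) (hshift.sub hu2)
  refine congrArg (k h * ·) (hpl.symm.trans (lintegral_congr fun ξ => ?_))
  rw [← mul_pow, ← enorm_mul, ← fourier_translate_sub hu h ξ]
  rfl

/-- Hölder's inequality applied to the increments of `|f|^β f`. -/
theorem eLpNorm_translate_abs_rpow_mul_sub_le {β p q : ℝ} (hβ : 0 < β) (hp : 0 < p) (hq : 0 < q)
    (hpq : β / p + 1 / q = 1 / 2) {f : E → ℝ} (hf : Continuous f) (h : E) :
    eLpNorm (fun x => |f (x + h)| ^ β * f (x + h) - |f x| ^ β * f x) 2 volume ≤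
      ENNReal.ofReal (2 * (β + 2)) * eLpNorm f (ENNReal.ofReal p) volume ^ β *
        eLpNorm (fun x => f (x + h) - f x) (ENNReal.ofReal q) volume := by
  have hr : 0 < p / β := by positivity
  have hr1 : 1 ≤ ENNReal.ofReal (p / β) := by
    rw [ENNReal.one_le_ofReal, one_le_div hβ]
    have h1 : β / p ≤ 1 := by linarith [one_div_pos.2 hq]
    rwa [div_le_one hp] at h1
  have hm : Continuous fun x => f (x + h) := by fun_prop
  have hmp := measurePreserving_add_right (volume : Measure E) h
  have hpow : ∀ g : E → ℝ, eLpNorm (fun x => |g x| ^ β) (ENNReal.ofReal (p / β)) volume =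
      eLpNorm g (ENNReal.ofReal p) volume ^ β := fun g => by
    have := eLpNorm_norm_rpow (μ := volume) (p := ENNReal.ofReal (p / β)) g hβ
    rw [← ENNReal.ofReal_mul hr.le, div_mul_cancel₀ _ hβ.ne'] at this
    exact this
  have hshift : eLpNorm (fun x => f (x + h)) (ENNReal.ofReal p) volume =
      eLpNorm f (ENNReal.ofReal p) volume :=
    eLpNorm_comp_measurePreserving (p := ENNReal.ofReal p) hf.aestronglyMeasurable hmp
  have hA : Continuous fun x => |f (x + h)| ^ β := hm.abs.rpow_const fun _ => Or.inr hβ.le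
  have hB : Continuous fun x => |f x| ^ β := hf.abs.rpow_const fun _ => Or.inr hβ.le
  have hD : Continuous fun x => f (x + h) - f x := hm.sub hf
  have htriple : ENNReal.HolderTriple (ENNReal.ofReal (p / β)) (ENNReal.ofReal q) 2 := ⟨by
    rw [← ENNReal.ofReal_inv_of_pos hr, ← ENNReal.ofReal_inv_of_pos hq,
      ← ENNReal.ofReal_add (by positivity) (by positivity), inv_div, ← one_div q, hpq]
    rw [one_div, ENNReal.ofReal_inv_of_pos two_pos]
    simp⟩
  have hsum : eLpNorm ((fun x => |f (x + h)| ^ β) + fun x => |f x| ^ β) (ENNReal.ofReal (p / β))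
      volume ≤ 2 * eLpNorm f (ENNReal.ofReal p) volume ^ β := by
    refine (eLpNorm_add_le hA.aestronglyMeasurable hB.aestronglyMeasurable hr1).trans_eq ?_
    rw [hpow f, hpow fun x => f (x + h), hshift, two_mul]
  calc _ ≤ ENNReal.ofReal (β + 2) * eLpNorm (((fun x => |f (x + h)| ^ β) + fun x => |f x| ^ β) •
        fun x => f (x + h) - f x) 2 volume := by
        refine eLpNorm_le_mul_eLpNorm_of_ae_le_mul (Filter.Eventually.of_forall fun x => ?_) 2
        have h1 := abs_rpow_mul_sub_le hβ.le (f (x + h)) (f x)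
        have h2 : 0 ≤ |f (x + h)| ^ β + |f x| ^ β := by positivity
        simpa only [Pi.smul_apply', Pi.add_apply, smul_eq_mul, norm_mul, Real.norm_eq_abs,
          abs_of_nonneg h2] using h1
    _ ≤ ENNReal.ofReal (β + 2) * (2 * eLpNorm f (ENNReal.ofReal p) volume ^ β *
        eLpNorm (fun x => f (x + h) - f x) (ENNReal.ofReal q) volume) := by
        refine mul_le_mul_right ((eLpNorm_smul_le_mul_eLpNorm hD.aestronglyMeasurable
          (hA.add hB).aestronglyMeasurable).trans (mul_le_mul_left hsum _)) _
    _ = _ := by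
        rw [ENNReal.ofReal_mul two_pos.le, ENNReal.ofReal_ofNat]
        ring

theorem eLpNorm_two_sq {X F : Type*} [MeasurableSpace X] {μ : Measure X} [NormedAddCommGroup F]
    (w : X → F) : eLpNorm w 2 μ ^ 2 = ∫⁻ x, ‖w x‖ₑ ^ 2 ∂μ := by
  rw [eLpNorm_eq_lintegral_rpow_enorm_toReal (by norm_num) (by norm_num), ← ENNReal.rpow_natCast,
    ← ENNReal.rpow_mul]
  simp

theorem lintegral_rpow_mul_fourier_abs_rpow_mul_le [Nontrivial E] {β p q s σ : ℝ} (hβ : 0 < β)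
    (hp : 0 < p) (hq : 2 < q) (hpq : β / p + 1 / q = 1 / 2) (hs : s ∈ Set.Ioo (0 : ℝ) 1)
    (hσ : σ = (Module.finrank ℝ E : ℝ) * (1 / 2 - 1 / q)) :
    ∃ C > (0 : ℝ), ∀ f : SchwartzMap E ℝ,
      ∫⁻ ξ : E, ENNReal.ofReal (‖ξ‖ ^ (2 * s)) *
          ‖𝓕 (fun y : E => ((|f y| ^ β * f y : ℝ) : ℂ)) ξ‖ₑ ^ 2 ≤
        (ENNReal.ofReal C * eLpNorm f (ENNReal.ofReal p) volume ^ β) ^ 2 *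
          ∫⁻ ξ : E, ENNReal.ofReal (‖ξ‖ ^ (2 * (s + σ))) *
            ‖𝓕 (fun y : E => ((f y : ℝ) : ℂ)) ξ‖ₑ ^ 2 := by
  obtain ⟨K, hK0, hKt, hK⟩ := exists_lintegral_gagliardo_symbol (E := E) hs
  obtain ⟨C, hC0, hC⟩ := exists_lintegral_fourier_rpow_le (E := E) hq hσ
  have hq0 : 0 < q := by linarith
  have hσ0 : 0 ≤ σ := by
    rw [hσ]
    have : 1 / q ≤ 1 / 2 := one_div_le_one_div_of_le two_pos hq.le
    exact mul_nonneg (Nat.cast_nonneg _) (by linarith)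
  set k : E → ℝ≥0∞ := fun h => ENNReal.ofReal (‖h‖ ^ (-((Module.finrank ℝ E : ℝ) + 2 * s)))
  have hk : Measurable k := by fun_prop
  refine ⟨2 * (β + 2) * C ^ (1 / q), by positivity, fun f => ?_⟩
  set u : E → ℂ := fun y => ((f y : ℝ) : ℂ) with hu
  set g : E → ℂ := fun y => ((|f y| ^ β * f y : ℝ) : ℂ) with hg
  set N := eLpNorm f (ENNReal.ofReal p) volume
  have hfc : Continuous f := f.continuous
  have huc : Continuous u := by fun_prop
  have hui : Integrable u := f.integrable.ofReal
  have hgc : Continuous g := Complex.continuous_ofReal.comp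
    ((hfc.abs.rpow_const fun _ => Or.inr hβ.le).mul hfc)
  have hgf : ∀ x, ‖g x‖ ≤ (SchwartzMap.seminorm ℝ 0 0 f) ^ β * ‖f x‖ := fun x => by
    rw [hg, Complex.norm_real, norm_mul, Real.norm_of_nonneg (by positivity)]
    gcongr
    exact SchwartzMap.norm_le_seminorm ℝ f x
  have hgi : Integrable g := (f.integrable.norm.const_mul _).mono' hgc.aestronglyMeasurable
    (Filter.Eventually.of_forall hgf)
  have hg2 : MemLp g 2 := (f.memLp 2 volume).of_le_mul hgc.aestronglyMeasurable
    (Filter.Eventually.of_forall hgf)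
  obtain ⟨φ, hφ⟩ : ∃ φ : SchwartzMap E ℂ, 𝓕 u = φ :=
    ⟨𝓕 (SchwartzMap.postcompCLM Complex.ofRealCLM f),
      (SchwartzMap.fourier_coe (SchwartzMap.postcompCLM Complex.ofRealCLM f)).symm⟩
  have hFui : Integrable (𝓕 u) := hφ ▸ φ.integrable
  have hFu2 : MemLp (𝓕 u) 2 := hφ ▸ φ.memLp 2 volume
  set M : E → ℝ≥0∞ := fun h => ∫⁻ ξ, ENNReal.ofReal (‖ξ‖ ^ (2 * σ)) *
      (‖(𝐞 (inner ℝ h ξ) - 1 : ℂ)‖ₑ ^ 2 * ‖𝓕 u ξ‖ₑ ^ 2) with hM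
  set c : ℝ≥0∞ := (ENNReal.ofReal (2 * (β + 2) * C ^ (1 / q)) * N ^ β) ^ 2 with hc
  have hdiff : ∀ h, ∫⁻ x, ‖g (x + h) - g x‖ₑ ^ 2 ≤ c * M h := fun h => by
    have hD : eLpNorm (fun x => f (x + h) - f x) (ENNReal.ofReal q) volume ≤
        ENNReal.ofReal (C ^ (1 / q)) * M h ^ (1 / 2 : ℝ) := by
      rw [eLpNorm_eq_lintegral_rpow_enorm_toReal (by simpa using hq0) ENNReal.ofReal_ne_top,
        ENNReal.toReal_ofReal hq0.le]
      have h1 : ∀ x, ‖f (x + h) - f x‖ₑ = ‖u (x + h) - u x‖ₑ := fun x => by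
        rw [hu, ← Complex.ofReal_sub, ← ofReal_norm, ← ofReal_norm, Complex.norm_real]
      simp only [h1]
      calc _ ≤ (ENNReal.ofReal C * M h ^ (q / 2)) ^ (1 / q) := by
            gcongr
            exact lintegral_translate_sub_rpow_le hC huc hui hFui hFu2 h
        _ = _ := by
            rw [ENNReal.mul_rpow_of_nonneg _ _ (by positivity), ← ENNReal.rpow_mul,
              ENNReal.ofReal_rpow_of_pos hC0]
            congr 2
            field_simp
    have h2 : ∀ x, ‖g (x + h) - g x‖ₑ =
        ‖|f (x + h)| ^ β * f (x + h) - |f x| ^ β * f x‖ₑ := fun x => by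
      rw [hg, ← Complex.ofReal_sub, ← ofReal_norm, ← ofReal_norm, Complex.norm_real]
    have h3 : (M h ^ (1 / 2 : ℝ)) ^ 2 = M h := by
      rw [← ENNReal.rpow_natCast, ← ENNReal.rpow_mul]; norm_num
    simp only [h2]
    calc _ = eLpNorm (fun x => |f (x + h)| ^ β * f (x + h) - |f x| ^ β * f x) 2 volume ^ 2 :=
          (eLpNorm_two_sq _).symm
      _ ≤ (ENNReal.ofReal (2 * (β + 2)) * N ^ β *
            (ENNReal.ofReal (C ^ (1 / q)) * M h ^ (1 / 2 : ℝ))) ^ 2 :=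
          pow_le_pow_left' ((eLpNorm_translate_abs_rpow_mul_sub_le hβ hp hq0 hpq hfc h).trans
            (mul_le_mul_right hD _)) 2
      _ = (ENNReal.ofReal (2 * (β + 2)) * ENNReal.ofReal (C ^ (1 / q)) * N ^ β) ^ 2 *
            (M h ^ (1 / 2 : ℝ)) ^ 2 := by ring
      _ = c * M h := by rw [h3, hc, ENNReal.ofReal_mul (p := 2 * (β + 2)) (by positivity)]
  have hN : N ≠ ⊤ := (f.eLpNorm_lt_top (ENNReal.ofReal p) volume).ne
  have hct : c ≠ ⊤ := by
    rw [hc]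
    exact ENNReal.pow_ne_top
      (ENNReal.mul_ne_top ENNReal.ofReal_ne_top (ENNReal.rpow_ne_top_of_nonneg hβ.le hN))
  have hmain : K * ∫⁻ ξ, ENNReal.ofReal (‖ξ‖ ^ (2 * s)) * ‖𝓕 g ξ‖ₑ ^ 2 ≤
      K * (c * ∫⁻ ξ, ENNReal.ofReal (‖ξ‖ ^ (2 * (s + σ))) * ‖𝓕 u ξ‖ₑ ^ 2) := by
    have hv : Measurable fun ξ => ENNReal.ofReal (‖ξ‖ ^ (2 * σ)) * ‖𝓕 u ξ‖ₑ ^ 2 :=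
      Measurable.mul (by fun_prop) ((continuous_fourier hui).enorm.measurable.pow_const 2)
    calc _ = ∫⁻ h, k h * ∫⁻ x, ‖g (x + h) - g x‖ₑ ^ 2 := (lintegral_gagliardo_eq hk hK hgi hg2).symm
      _ ≤ ∫⁻ h, c * (k h * M h) := lintegral_mono fun h => by
          rw [mul_left_comm]
          exact mul_le_mul_right (hdiff h) _
      _ = c * ∫⁻ h, k h * M h := lintegral_const_mul' _ _ hct
      _ = c * (K * ∫⁻ ξ, ENNReal.ofReal (‖ξ‖ ^ (2 * (s + σ))) * ‖𝓕 u ξ‖ₑ ^ 2) := by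
          simp only [hM, mul_left_comm (ENNReal.ofReal (‖_‖ ^ (2 * σ)))]
          rw [lintegral_mul_lintegral_mul_eq hk measurable_enorm_fourierChar_inner_sub_one_sq
            (by fun_prop) hv hK]
          congr 2
          refine lintegral_congr fun ξ => ?_
          rw [← mul_assoc, ← ENNReal.ofReal_mul (by positivity), mul_add,
            Real.rpow_add_of_nonneg (norm_nonneg _) (by linarith [hs.1]) (by linarith)]
      _ = _ := mul_left_comm _ _ _
  exact (ENNReal.mul_le_mul_iff_right hK0 hKt).1 hmain

end Euclidean

/-- Fractional product estimate for powers: for `γ ≥ 2`, `s ∈ (0,1)` and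
`α < 2` with `α > (γ-4)/(γ-2)` when `γ ≠ 2`,
`‖|f|^{γ-2} f‖_{Ḣ^s} ≤ C ‖f‖_{L^{2γ/(2-α)}}^{γ-2} ‖f‖_{Ḣ^{s + (d/2 - d/γ)(2-α)}}`,
where `‖g‖_{Ḣ^t} = (∫ (2π|ξ|)^{2t} |𝓕g(ξ)|² dξ)^{1/2}`. -/
theorem fractional_power_product_estimate
    (d : ℕ) (hd : 1 ≤ d) (γ s α : ℝ) (hγ : 2 ≤ γ) (hs : s ∈ Set.Ioo (0 : ℝ) 1)
    (hα₂ : α < 2) (hα₁ : γ ≠ 2 → (γ - 4) / (γ - 2) < α) :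
    ∃ C > (0 : ℝ), ∀ f : SchwartzMap (EuclideanSpace ℝ (Fin d)) ℝ,
      (∫⁻ ξ : EuclideanSpace ℝ (Fin d),
          ENNReal.ofReal ((2 * Real.pi * ‖ξ‖) ^ (2 * s)
            * ‖𝓕 (fun y : EuclideanSpace ℝ (Fin d) =>
                ((|f y| ^ (γ - 2) * f y : ℝ) : ℂ)) ξ‖ ^ 2)) ^ (1 / 2 : ℝ)
        ≤ ENNReal.ofReal
              (C * (eLpNorm (⇑f) (ENNReal.ofReal (2 * γ / (2 - α))) volume).toReal ^ (γ - 2))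
            * (∫⁻ ξ : EuclideanSpace ℝ (Fin d),
                ENNReal.ofReal
                  ((2 * Real.pi * ‖ξ‖) ^ (2 * (s + ((d : ℝ) / 2 - (d : ℝ) / γ) * (2 - α)))
                    * ‖𝓕 (fun y : EuclideanSpace ℝ (Fin d) =>
                        ((f y : ℝ) : ℂ)) ξ‖ ^ 2)) ^ (1 / 2 : ℝ) := by
  rcases hγ.eq_or_lt with rfl | hγ
  · refine ⟨1, one_pos, fun f => ?_⟩
    simp
  have hfin : (Module.finrank ℝ (EuclideanSpace ℝ (Fin d)) : ℝ) = d := by simp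
  have : Nontrivial (EuclideanSpace ℝ (Fin d)) :=
    Module.nontrivial_of_finrank_pos (R := ℝ) (by rw [finrank_euclideanSpace_fin]; exact hd)
  have hα : 0 < 2 - α := by linarith
  have hβ : 0 < γ - 2 := by linarith
  have hγ0 : 0 < γ := by linarith
  have hα₁ := hα₁ hγ.ne'
  rw [div_lt_iff₀ hβ] at hα₁
  have hτ0 : 0 < 1 / 2 - (γ - 2) * (2 - α) / (2 * γ) := by
    rw [sub_pos, div_lt_div_iff₀ (by positivity) two_pos]
    nlinarith
  have hτ1 : 1 / 2 - (γ - 2) * (2 - α) / (2 * γ) < 1 / 2 := by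
    have : 0 < (γ - 2) * (2 - α) / (2 * γ) := by positivity
    linarith
  set τ := 1 / 2 - (γ - 2) * (2 - α) / (2 * γ) with hτ
  set σ := ((d : ℝ) / 2 - (d : ℝ) / γ) * (2 - α) with hσ
  have hσn : σ = (Module.finrank ℝ (EuclideanSpace ℝ (Fin d)) : ℝ) * (1 / 2 - 1 / τ⁻¹) := by
    rw [hfin, hσ, one_div τ⁻¹, inv_inv, hτ]
    field_simp
    ring
  have hσ0 : 0 ≤ σ := by
    rw [hσn, one_div τ⁻¹, inv_inv]
    exact mul_nonneg (Nat.cast_nonneg _) (by linarith)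
  obtain ⟨C, hC0, hC⟩ := lintegral_rpow_mul_fourier_abs_rpow_mul_le
    (E := EuclideanSpace ℝ (Fin d)) hβ (p := 2 * γ / (2 - α)) (q := τ⁻¹) (by positivity)
    (by rw [lt_inv_comm₀ two_pos hτ0]; linarith)
    (by rw [one_div τ⁻¹, inv_inv, hτ]; field_simp; ring) hs hσn
  refine ⟨C, hC0, fun f => ?_⟩
  have hsplit : ∀ (t : ℝ) (F : EuclideanSpace ℝ (Fin d) → ℂ),
      ∫⁻ ξ, ENNReal.ofReal ((2 * Real.pi * ‖ξ‖) ^ t * ‖F ξ‖ ^ 2) =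
        ENNReal.ofReal ((2 * Real.pi) ^ t) * ∫⁻ ξ, ENNReal.ofReal (‖ξ‖ ^ t) * ‖F ξ‖ₑ ^ 2 :=
    fun t F => by
      rw [← lintegral_const_mul' _ _ ENNReal.ofReal_ne_top]
      refine lintegral_congr fun ξ => ?_
      rw [Real.mul_rpow (by positivity) (norm_nonneg _), ENNReal.ofReal_mul (by positivity),
        ENNReal.ofReal_mul (by positivity), ENNReal.ofReal_pow (norm_nonneg _), ofReal_norm,
        mul_assoc]
  rw [hsplit, hsplit]
  set X := ENNReal.ofReal C * eLpNorm f (ENNReal.ofReal (2 * γ / (2 - α))) volume ^ (γ - 2) with hX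
  have hN : eLpNorm f (ENNReal.ofReal (2 * γ / (2 - α))) volume ≠ ⊤ :=
    (f.eLpNorm_lt_top (ENNReal.ofReal (2 * γ / (2 - α))) volume).ne
  have hXeq : ENNReal.ofReal
      (C * (eLpNorm (⇑f) (ENNReal.ofReal (2 * γ / (2 - α))) volume).toReal ^ (γ - 2)) = X := by
    rw [ENNReal.ofReal_mul hC0.le, ← ENNReal.ofReal_rpow_of_nonneg ENNReal.toReal_nonneg hβ.le,
      ENNReal.ofReal_toReal hN]
  have hpi : (1 : ℝ) ≤ 2 * Real.pi := by linarith [Real.two_le_pi]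
  have hX2 : X = (X ^ 2) ^ (1 / 2 : ℝ) := by
    rw [← ENNReal.rpow_natCast, ← ENNReal.rpow_mul]; norm_num
  rw [hXeq, hX2, ← ENNReal.mul_rpow_of_nonneg _ _ (by norm_num), mul_left_comm]
  gcongr
  · linarith
  · exact hC f
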